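/- arXiv:1004.0231 — 7 statements merged into one kernel-verified Lean document; each statement's English description precedes it below -/
import Mathlib

section
/- Assume a² + ab/√λθ ≤ λ∞. Then the unique a* ∈ (−λθ, ∞) with f(a*) = 1 satisfies −λθ < a* ≤ 0 and is given explicitly by a* = −(λ∞ + λθ)/2 + √( ((λ∞ − λθ)/2)² + λθ·(a² + ab/√λθ) ). -/
/-- The function f of Theorem 4.4 restricted to the real axis (piecewise definition
on (−λθ, ∞); the values for t ≤ −λθ are irrelevant junk). Here `lt = λθ`, `li = λ∞`,
`a = ‖α‖`, `b = ‖α'‖`. -/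
noncomputable def dynamoF (lt li a b : ℝ) (t : ℝ) : ℝ :=
  if t ≤ 0 then (a ^ 2 * lt + a * b * Real.sqrt lt) / ((t + lt) * (t + li))
  else if t ≤ lt then (a ^ 2 + a * b * Real.sqrt lt / (t + lt)) / (t + li)
  else (a ^ 2 + a * b / (2 * Real.sqrt t)) / (t + li)

/-- Theorem 4.4, case (i): if a² + ab/√λθ ≤ λ∞, then the unique solution
a* ∈ (−λθ, ∞) of f(a*) = 1 satisfies −λθ < a* ≤ 0 and is given explicitly by
a* = −(λ∞+λθ)/2 + √(((λ∞−λθ)/2)² + λθ(a² + ab/√λθ)). -/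
theorem stmt_4 (lt li a b : ℝ) (hlt : 0 < lt) (hli : lt < li) (ha : 0 < a) (hb : 0 ≤ b)
    (hcase : a ^ 2 + a * b / Real.sqrt lt ≤ li) :
    ∃ x : ℝ, (-lt < x ∧ x ≤ 0) ∧ dynamoF lt li a b x = 1 ∧
      (∀ y : ℝ, -lt < y → dynamoF lt li a b y = 1 → y = x) ∧
      x = -(li + lt) / 2
        + Real.sqrt (((li - lt) / 2) ^ 2 + lt * (a ^ 2 + a * b / Real.sqrt lt)) := by
  have hs : 0 < Real.sqrt lt := Real.sqrt_pos.mpr hlt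
  have hss : Real.sqrt lt ^ 2 = lt := Real.sq_sqrt hlt.le
  have hc : 0 ≤ a * b := mul_nonneg ha.le hb
  have hcs : 0 ≤ a * b / Real.sqrt lt := div_nonneg hc hs.le
  have hnum : a ^ 2 * lt + a * b * Real.sqrt lt
      = lt * (a ^ 2 + a * b / Real.sqrt lt) := by
    have h1 : lt * (a * b / Real.sqrt lt) = a * b * Real.sqrt lt := by
      rw [← mul_div_assoc, div_eq_iff hs.ne']
      linear_combination (-(a * b)) * hss
    linear_combination -h1
  have hKpos : 0 < a ^ 2 + a * b / Real.sqrt lt := by positivity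
  set K := a ^ 2 + a * b / Real.sqrt lt with hK
  have hlK : 0 < lt * K := mul_pos hlt hKpos
  have hlK2 : lt * K ≤ lt * li := mul_le_mul_of_nonneg_left hcase hlt.le
  set D := Real.sqrt (((li - lt) / 2) ^ 2 + lt * K) with hD
  have hDD : D ^ 2 = ((li - lt) / 2) ^ 2 + lt * K := Real.sq_sqrt (by positivity)
  have hD1 : (li - lt) / 2 < D := by
    apply Real.lt_sqrt_of_sq_lt
    linarith
  have hD2 : D ≤ (li + lt) / 2 := by
    apply Real.sqrt_le_iff.mpr
    constructor
    · linarith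
    · nlinarith
  have hx1 : -lt < -(li + lt) / 2 + D := by linarith
  have hx0 : -(li + lt) / 2 + D ≤ 0 := by linarith
  refine ⟨-(li + lt) / 2 + D, ⟨hx1, hx0⟩, ?_, ?_, rfl⟩
  · unfold dynamoF
    rw [if_pos hx0, hnum, div_eq_one_iff_eq]
    · linear_combination -hDD
    · apply ne_of_gt
      apply mul_pos <;> linarith
  · intro y hy hf
    unfold dynamoF at hf
    have hyl : 0 < y + lt := by linarith
    have hyi : 0 < y + li := by linarith
    split_ifs at hf with h0 h1
    · rw [hnum, div_eq_one_iff_eq (mul_pos hyl hyi).ne'] at hf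
      have h2 : (y - (-(li + lt) / 2 + D)) * (y + (li + lt) / 2 + D) = 0 := by
        linear_combination -hf - hDD
      rcases mul_eq_zero.mp h2 with h | h
      · linarith
      · linarith
    · rw [div_eq_one_iff_eq hyi.ne'] at hf
      have h3 : a * b * Real.sqrt lt / (y + lt) ≤ a * b / Real.sqrt lt := by
        rw [div_le_div_iff₀ hyl hs]
        have : a * b * Real.sqrt lt * Real.sqrt lt = a * b * lt := by
          linear_combination (a * b) * hss
        rw [this]
        apply mul_le_mul_of_nonneg_left _ hc
        linarith
      linarith
    · rw [div_eq_one_iff_eq hyi.ne'] at hf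
      have h4 : Real.sqrt lt ≤ Real.sqrt y := Real.sqrt_le_sqrt (by linarith)
      have h3 : a * b / (2 * Real.sqrt y) ≤ a * b / Real.sqrt lt := by
        apply div_le_div_of_nonneg_left hc hs
        linarith
      linarith
end

section
/- Assume a² + ab/√λθ > λ∞ and a² + ab/(2√λθ) ≤ λ∞ + λθ. Then the unique a* ∈ (−λθ, ∞) with f(a*) = 1 satisfies 0 < a* ≤ λθ and is given explicitly by a* = −(λ∞ + λθ − a²)/2 + √( ((λ∞ − λθ − a²)/2)² + ab√λθ ). -/
/-- Theorem 4.4, case (ii): if a² + ab/√λθ > λ∞ and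
a² + ab/(2√λθ) ≤ λ∞ + λθ, then the unique solution a* ∈ (−λθ, ∞) of f(a*) = 1
satisfies 0 < a* ≤ λθ and is given explicitly by
a* = −(λ∞+λθ−a²)/2 + √(((λ∞−λθ−a²)/2)² + ab√λθ). -/
theorem stmt_5 (lt li a b : ℝ) (hlt : 0 < lt) (hli : lt < li) (ha : 0 < a) (hb : 0 ≤ b)
    (hcase1 : li < a ^ 2 + a * b / Real.sqrt lt)
    (hcase2 : a ^ 2 + a * b / (2 * Real.sqrt lt) ≤ li + lt) :
    ∃ x : ℝ, (0 < x ∧ x ≤ lt) ∧ dynamoF lt li a b x = 1 ∧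
      (∀ y : ℝ, -lt < y → dynamoF lt li a b y = 1 → y = x) ∧
      x = -(li + lt - a ^ 2) / 2
        + Real.sqrt (((li - lt - a ^ 2) / 2) ^ 2 + a * b * Real.sqrt lt) := by
  obtain ⟨s, hs⟩ : ∃ s, s = Real.sqrt lt := ⟨_, rfl⟩
  have hs0 : 0 < s := by rw [hs]; exact Real.sqrt_pos.mpr hlt
  have hss : s ^ 2 = lt := by rw [hs]; exact Real.sq_sqrt hlt.le
  obtain ⟨c, hc⟩ : ∃ c, c = a * b := ⟨_, rfl⟩
  have hc0 : 0 ≤ c := by rw [hc]; positivity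
  unfold dynamoF
  rw [← hs, ← hc] at hcase1 hcase2 ⊢
  have e1 : c / s * lt = c * s := by rw [← hss]; field_simp
  have e2 : c / (2 * s) * (2 * lt) = c * s := by rw [← hss]; field_simp
  have h1 : li * lt < a ^ 2 * lt + c * s := by
    have := mul_lt_mul_of_pos_right hcase1 hlt
    rw [add_mul, e1] at this; exact this
  have h2 : a ^ 2 * (2 * lt) + c * s ≤ (li + lt) * (2 * lt) := by
    have := mul_le_mul_of_nonneg_right hcase2 (by positivity : 0 ≤ 2 * lt)
    rw [add_mul, e2] at this; exact this
  have hcs : 0 ≤ c * s := by positivity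
  obtain ⟨r, hr⟩ : ∃ r, r = Real.sqrt (((li - lt - a ^ 2) / 2) ^ 2 + c * s) := ⟨_, rfl⟩
  have hr0 : 0 ≤ r := by rw [hr]; exact Real.sqrt_nonneg _
  have hrr : r ^ 2 = ((li - lt - a ^ 2) / 2) ^ 2 + c * s := by
    rw [hr]; exact Real.sq_sqrt (by positivity)
  rw [← hr]
  obtain ⟨x, hx⟩ : ∃ x, x = -(li + lt - a ^ 2) / 2 + r := ⟨_, rfl⟩
  have hq : (x + lt) * (x + li) = a ^ 2 * (x + lt) + c * s := by
    have : r = x + (li + lt - a ^ 2) / 2 := by rw [hx]; ring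
    rw [this] at hrr
    linarith
  have habs : |(li + lt - a ^ 2) / 2| < r := by
    refine abs_lt_of_sq_lt_sq ?_ hr0
    nlinarith
  have hx0 : 0 < x := by
    have := (abs_lt.mp habs).2
    rw [hx]; linarith
  have hxp : 0 < x + (li + lt - a ^ 2) := by
    have := (abs_lt.mp habs).1
    rw [hx]; linarith
  have hxl : x ≤ lt := by
    by_contra! h
    nlinarith [mul_pos (sub_pos.mpr h) (by linarith : 0 < x + (li + lt - a ^ 2) + lt)]
  refine ⟨x, ⟨hx0, hxl⟩, ?_, ?_, hx⟩
  · rw [if_neg (not_le.mpr hx0), if_pos hxl, div_eq_one_iff_eq (by linarith)]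
    have : x + lt ≠ 0 := by linarith
    field_simp
    linarith
  · intro y hy hf
    split_ifs at hf with g1 g2
    · have p1 : 0 < y + lt := by linarith
      have p2 : 0 < y + li := by linarith
      rw [div_eq_one_iff_eq (mul_pos p1 p2).ne'] at hf
      nlinarith
    · rw [div_eq_one_iff_eq (by linarith)] at hf
      have p1 : y + lt ≠ 0 := by linarith
      field_simp at hf
      have : (y - x) * (y + (x + (li + lt - a ^ 2))) = 0 := by linarith
      rcases mul_eq_zero.mp this with h | h
      · linarith
      · linarith
    · rw [div_eq_one_iff_eq (by linarith)] at hf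
      push Not at g1 g2
      have h3 : s ≤ Real.sqrt y := by rw [hs]; exact Real.sqrt_le_sqrt g2.le
      have h4 : c / (2 * Real.sqrt y) ≤ c / (2 * s) := by gcongr
      linarith
end

section
/- If a² + ab/√λθ < λ∞, then f(t) < 1 for every t ≥ 0; equivalently, the unique solution a* ∈ (−λθ, ∞) of f(a*) = 1 is strictly negative. -/
/-- real-analytic core of the anti-dynamo theorem, Corollary 4.5:
if a² + ab/√λθ < λ∞, then f(t) < 1 for every t ≥ 0; equivalently, any solution
a* ∈ (−λθ, ∞) of f(a*) = 1 is strictly negative. -/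
theorem stmt_7 (lt li a b : ℝ) (hlt : 0 < lt) (hli : lt < li) (ha : 0 < a) (hb : 0 ≤ b)
    (hcase : a ^ 2 + a * b / Real.sqrt lt < li) :
    (∀ t : ℝ, 0 ≤ t → dynamoF lt li a b t < 1) ∧
    (∀ x : ℝ, -lt < x → dynamoF lt li a b x = 1 → x < 0) := by
  have hs : 0 < Real.sqrt lt := Real.sqrt_pos.mpr hlt
  have hss : Real.sqrt lt * Real.sqrt lt = lt := Real.mul_self_sqrt hlt.le
  have hab : 0 ≤ a * b := mul_nonneg ha.le hb
  have key : ∀ t : ℝ, 0 ≤ t → dynamoF lt li a b t < 1 := by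
    intro t ht
    have htl : 0 < t + li := by linarith
    unfold dynamoF
    split_ifs with h1 h2
    · have h0 : t = 0 := le_antisymm h1 ht
      subst h0
      have e : a ^ 2 * lt + a * b * Real.sqrt lt = (a ^ 2 + a * b / Real.sqrt lt) * lt := by
        have : a * b / Real.sqrt lt * lt = a * b * Real.sqrt lt := by
          rw [div_mul_eq_mul_div, div_eq_iff hs.ne', mul_assoc (a * b), hss]
        rw [add_mul, this]
      rw [zero_add, zero_add, div_lt_one (by nlinarith), e, mul_comm lt li]
      exact mul_lt_mul_of_pos_right hcase hlt
    · rw [div_lt_one htl]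
      have : a * b * Real.sqrt lt / (t + lt) ≤ a * b / Real.sqrt lt := by
        rw [div_le_div_iff₀ (by linarith) hs, mul_assoc, hss]
        exact mul_le_mul_of_nonneg_left (by linarith) hab
      linarith
    · rw [div_lt_one htl]
      have hst : Real.sqrt lt ≤ Real.sqrt t := Real.sqrt_le_sqrt (by linarith)
      have : a * b / (2 * Real.sqrt t) ≤ a * b / Real.sqrt lt :=
        div_le_div_of_nonneg_left hab hs (by linarith)
      linarith
  refine ⟨key, fun x _ hx => ?_⟩
  by_contra h
  exact absurd hx (key x (not_lt.mp h)).ne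
end

section
/- Let λθ, λ∞ be real with 0 < λθ < λ∞ and a ≥ 0. Then the infimum over γ ∈ (0,1] of max{ −(1−γ)λθ, −λ∞ + a²/γ } equals s(a). Moreover, if a > 0 the infimum is attained: at γ₀ = ( −(λ∞−λθ)/2 + √(((λ∞−λθ)/2)² + λθa²) )/λθ when a² ≤ λ∞, and at γ = 1 when a² ≥ λ∞. -/
/-- The upper bound s_θ = s(a) for the self-adjoint part S_θ of the transformed
dynamo operator (Proposition 5.8): here `lt = λθ`, `li = λ∞`, `a = ‖α‖`. -/
noncomputable def sBound (lt li a : ℝ) : ℝ :=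
  if a ^ 2 ≤ li then -(li + lt) / 2 + Real.sqrt (((li - lt) / 2) ^ 2 + lt * a ^ 2)
  else -li + a ^ 2

/-- computational content of Proposition 5.8: the infimum over γ ∈ (0,1]
of max{−(1−γ)λθ, −λ∞ + a²/γ} equals s(a); moreover, if a > 0 the infimum is attained
at γ₀ = (−(λ∞−λθ)/2 + √(((λ∞−λθ)/2)² + λθa²))/λθ when a² ≤ λ∞, and at γ = 1
when a² ≥ λ∞. -/
theorem stmt_8 (lt li a : ℝ) (hlt : 0 < lt) (hli : lt < li) (ha : 0 ≤ a) :
    (⨅ γ : Set.Ioc (0 : ℝ) 1, max (-(1 - (γ : ℝ)) * lt) (-li + a ^ 2 / (γ : ℝ)))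
      = sBound lt li a ∧
    (0 < a →
      ((a ^ 2 ≤ li →
        (-(li - lt) / 2 + Real.sqrt (((li - lt) / 2) ^ 2 + lt * a ^ 2)) / lt
          ∈ Set.Ioc (0 : ℝ) 1 ∧
        max (-(1 - (-(li - lt) / 2 + Real.sqrt (((li - lt) / 2) ^ 2 + lt * a ^ 2)) / lt) * lt)
            (-li + a ^ 2 / ((-(li - lt) / 2 + Real.sqrt (((li - lt) / 2) ^ 2 + lt * a ^ 2)) / lt))
          = sBound lt li a) ∧
      (li ≤ a ^ 2 →
        max (-(1 - 1) * lt) (-li + a ^ 2 / 1) = sBound lt li a))) := by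
  have hD : 0 ≤ ((li - lt) / 2) ^ 2 + lt * a ^ 2 := by positivity
  have hr0 := Real.sqrt_nonneg (((li - lt) / 2) ^ 2 + lt * a ^ 2)
  have hr2 := Real.sq_sqrt hD
  unfold sBound
  generalize Real.sqrt (((li - lt) / 2) ^ 2 + lt * a ^ 2) = r at *
  obtain ⟨t, ht⟩ : ∃ t, t = -(li - lt) / 2 + r := ⟨_, rfl⟩
  have hs : -(li + lt) / 2 + r = t - lt := by rw [ht]; ring
  rw [hs, ← ht]
  have hrt : r = t + (li - lt) / 2 := by rw [ht]; ring
  have ht2 : t * (t + li - lt) = lt * a ^ 2 := by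
    rw [hrt] at hr2; linarith
  have ht0 : 0 ≤ t := by
    by_contra h
    push Not at h
    have h1 : 0 < t + li - lt := by linarith
    have h2 : 0 ≤ lt * a ^ 2 := by positivity
    nlinarith [mul_pos (neg_pos.2 h) h1]
  clear ht hs hr2 hD
  have hlow : ∀ γ : ℝ, 0 < γ → γ ≤ 1 →
      (if a ^ 2 ≤ li then t - lt else -li + a ^ 2) ≤
        max (-(1 - γ) * lt) (-li + a ^ 2 / γ) := by
    intro γ h0 h1
    split_ifs with h
    · rcases le_total t (γ * lt) with h2 | h2
      · exact le_max_of_le_left (by linarith)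
      · apply le_max_of_le_right
        have : t + li - lt ≤ a ^ 2 / γ := by
          rw [le_div_iff₀ h0]
          have h3 : (γ * lt) * (t + li - lt) ≤ t * (t + li - lt) :=
            mul_le_mul_of_nonneg_right h2 (by linarith)
          rw [ht2] at h3
          exact le_of_mul_le_mul_left (by linarith) hlt
        linarith
    · apply le_max_of_le_right
      have : a ^ 2 ≤ a ^ 2 / γ := le_div_self (by positivity) h0 h1
      linarith
  have hsmall : 0 < a → a ^ 2 ≤ li → t / lt ∈ Set.Ioc (0 : ℝ) 1 ∧
      max (-(1 - t / lt) * lt) (-li + a ^ 2 / (t / lt)) = t - lt := by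
    intro ha' h
    have hpos : 0 < lt * a ^ 2 := by positivity
    have htp : 0 < t := by
      rcases ht0.eq_or_lt with h' | h'
      · rw [← h'] at ht2; linarith
      · exact h'
    have htl : t ≤ lt := by
      by_contra h'
      push Not at h'
      nlinarith [mul_le_mul_of_nonneg_left h hlt.le]
    refine ⟨⟨by positivity, (div_le_one hlt).2 htl⟩, ?_⟩
    have e1 : -(1 - t / lt) * lt = t - lt := by field_simp; ring
    have e2 : a ^ 2 / (t / lt) = t + li - lt := by
      field_simp; linarith
    rw [e1, e2]
    have : -li + (t + li - lt) = t - lt := by ring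
    rw [this, max_self]
  have hlarge : li ≤ a ^ 2 → max (-(1 - 1) * lt) (-li + a ^ 2 / 1) =
      if a ^ 2 ≤ li then t - lt else -li + a ^ 2 := by
    intro h
    have : max (-(1 - 1) * lt) (-li + a ^ 2 / 1) = -li + a ^ 2 := by
      rw [div_one]; apply max_eq_right; linarith
    rw [this]
    split_ifs with h'
    · have e : a ^ 2 = li := le_antisymm h' h
      rw [e] at ht2 ⊢
      have : (t - lt) * (t + li) = 0 := by linarith
      rcases mul_eq_zero.1 this with h3 | h3 <;> linarith
    · rfl
  have hbdd : BddBelow (Set.range fun γ : Set.Ioc (0 : ℝ) 1 =>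
      max (-(1 - (γ : ℝ)) * lt) (-li + a ^ 2 / (γ : ℝ))) := by
    refine ⟨if a ^ 2 ≤ li then t - lt else -li + a ^ 2, ?_⟩
    · rintro _ ⟨γ, rfl⟩
      exact hlow γ γ.2.1 γ.2.2
  have : Nonempty (Set.Ioc (0 : ℝ) 1) := ⟨⟨1, by norm_num, le_rfl⟩⟩
  refine ⟨le_antisymm ?_ (le_ciInf fun γ => hlow γ γ.2.1 γ.2.2), ?_⟩
  · rcases le_total li (a ^ 2) with h | h
    · rw [← hlarge h]
      exact ciInf_le hbdd ⟨1, by norm_num, le_rfl⟩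
    · rw [if_pos h]
      rcases ha.eq_or_lt with h0 | h0
      · apply le_of_forall_pos_le_add
        intro ε hε
        have hm : min 1 (ε / lt) ∈ Set.Ioc (0 : ℝ) 1 :=
          ⟨lt_min one_pos (by positivity), min_le_left _ _⟩
        refine (ciInf_le hbdd ⟨_, hm⟩).trans ?_
        have h1 : min 1 (ε / lt) * lt ≤ ε := by
          have := mul_le_mul_of_nonneg_right (min_le_right 1 (ε / lt)) hlt.le
          rwa [div_mul_cancel₀ _ hlt.ne'] at this
        apply max_le
        · simp only
          linarith
        · simp only [← h0]
          norm_num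
          linarith
      · obtain ⟨hm, he⟩ := hsmall h0 h
        rw [← he]
        exact ciInf_le hbdd ⟨_, hm⟩
  · intro h0
    refine ⟨fun h => ?_, hlarge⟩
    rw [if_pos h]
    exact hsmall h0 h
end

section
/- For every t ∈ (0, √λ∞), one has k₁(t) < k₂(t). -/
/-- Lemma 6.1: with k₁(t) = (λ∞+λθ)/2 − √(((λ∞−λθ)/2)² + λθt²) and
k₂(t) = (λ∞ − t²)√λθ/t, one has k₁(t) < k₂(t) for every t ∈ (0, √λ∞). -/
theorem stmt_10 (lt li : ℝ) (hlt : 0 < lt) (hli : lt < li) :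
    ∀ t : ℝ, 0 < t → t < Real.sqrt li →
      (li + lt) / 2 - Real.sqrt (((li - lt) / 2) ^ 2 + lt * t ^ 2)
        < (li - t ^ 2) * Real.sqrt lt / t := by
  intro t ht htl
  have hL : t ^ 2 < li := (Real.lt_sqrt ht.le).1 htl
  have hs : 0 < Real.sqrt lt := Real.sqrt_pos.2 hlt
  have hs2 : Real.sqrt lt ^ 2 = lt := Real.sq_sqrt hlt.le
  have hB : 0 ≤ ((li - lt) / 2) ^ 2 + lt * t ^ 2 := by positivity
  have hr2 := Real.sq_sqrt hB
  have hr : Real.sqrt lt * t ≤ Real.sqrt (((li - lt) / 2) ^ 2 + lt * t ^ 2) := by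
    apply Real.le_sqrt_of_sq_le
    rw [mul_pow, hs2]
    nlinarith [sq_nonneg ((li - lt) / 2)]
  generalize Real.sqrt (((li - lt) / 2) ^ 2 + lt * t ^ 2) = r at *
  generalize Real.sqrt lt = s at *
  rw [lt_div_iff₀ ht]
  have hst : 0 < s * t := mul_pos hs ht
  have hpos : 0 < (li + lt) / 2 + r := by linarith
  have key : ((li + lt) / 2 - r) * ((li + lt) / 2 + r) = s ^ 2 * (li - t ^ 2) := by
    rw [hs2]; linear_combination -hr2
  have h1 : 0 < s * (li - t ^ 2) := mul_pos hs (by linarith)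
  have h2 : s * t < (li + lt) / 2 + r := by linarith
  refine lt_of_mul_lt_mul_right ?_ hpos.le
  calc ((li + lt) / 2 - r) * t * ((li + lt) / 2 + r)
      = (s * (li - t ^ 2)) * (s * t) := by linear_combination t * key
    _ < (s * (li - t ^ 2)) * ((li + lt) / 2 + r) := mul_lt_mul_of_pos_left h2 h1
    _ = _ := by ring
end

section
/- Let λθ, λ∞ be real with 0 < λθ < λ∞ and let t be a real number with √λ∞ ≤ t ≤ √λθ/2 + √(λ∞ − 3λθ/4). Set b = λ∞ − λθ + t√λθ − t². Then b ≥ 0 and −(λ∞ + λθ − t²)/2 + √( ((λ∞ − λθ − t²)/2)² + t·b·√λθ ) = −λ∞ + t² + b. -/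
/-- Lemma 6.2, the curve k₅: for 0 < λθ < λ∞ and
√λ∞ ≤ t ≤ √λθ/2 + √(λ∞ − 3λθ/4), set b = λ∞ − λθ + t√λθ − t². Then b ≥ 0 and
−(λ∞+λθ−t²)/2 + √(((λ∞−λθ−t²)/2)² + t·b·√λθ) = −λ∞ + t² + b, i.e. a_θ = b_θ on
the graph of k₅. -/
theorem stmt_17 (lt li t : ℝ) (hlt : 0 < lt) (hli : lt < li)
    (ht1 : Real.sqrt li ≤ t)
    (ht2 : t ≤ Real.sqrt lt / 2 + Real.sqrt (li - 3 * lt / 4)) :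
    0 ≤ li - lt + t * Real.sqrt lt - t ^ 2 ∧
    -(li + lt - t ^ 2) / 2
      + Real.sqrt (((li - lt - t ^ 2) / 2) ^ 2
          + t * (li - lt + t * Real.sqrt lt - t ^ 2) * Real.sqrt lt)
      = -li + t ^ 2 + (li - lt + t * Real.sqrt lt - t ^ 2) := by
  have hs : 0 < Real.sqrt lt := Real.sqrt_pos.mpr hlt
  have hss : Real.sqrt lt ^ 2 = lt := Real.sq_sqrt hlt.le
  have hst : Real.sqrt lt ≤ t := (Real.sqrt_le_sqrt hli.le).trans ht1
  have hr : Real.sqrt (li - 3 * lt / 4) ^ 2 = li - 3 * lt / 4 :=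
    Real.sq_sqrt (by linarith)
  generalize Real.sqrt lt = s at *
  have h1 : (t - s / 2) ^ 2 ≤ Real.sqrt (li - 3 * lt / 4) ^ 2 :=
    pow_le_pow_left₀ (by linarith) (by linarith) 2
  have hb : 0 ≤ li - lt + t * s - t ^ 2 := by nlinarith
  have hts : 0 < t * s := mul_pos (by linarith) hs
  refine ⟨hb, ?_⟩
  have h2 : ((li - lt - t ^ 2) / 2) ^ 2 + t * (li - lt + t * s - t ^ 2) * s
      = (t * s + (li - lt - t ^ 2) / 2) ^ 2 := by ring
  rw [h2, Real.sqrt_sq (by linarith)]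
  ring
end

section
/- Let H be a complex Hilbert space, A : H → H a bounded self-adjoint operator whose spectrum is contained in [0, ∞), and α₀ ∈ ℝ. Define the bounded operator T on H × H by T(x, y) = (−A x + α₀ y, α₀ A x − A y). Then the spectrum of T equals { z ∈ ℂ : there exists t in the spectrum of A with z = −t + α₀√t or z = −t − α₀√t }. -/
lemma aux_unit {H : Type*} [NormedAddCommGroup H] [InnerProductSpace ℂ H]
    [CompleteSpace H]
    (A D : H →L[ℂ] H) (c z : ℂ)
    (hD : ∀ x, D x = A (A x) + (2 * z) • A x + z ^ 2 • x - c ^ 2 • A x)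
    (M : WithLp 2 (H × H) →L[ℂ] WithLp 2 (H × H))
    (hM : ∀ x y : H,
      M (WithLp.toLp 2 (x, y)) =
        WithLp.toLp 2 (z • x + A x - c • y, z • y + A y - c • A x)) :
    IsUnit M ↔ IsUnit D := by
  rw [ContinuousLinearMap.isUnit_iff_bijective, ContinuousLinearMap.isUnit_iff_bijective]
  have hMe : ∀ x y u v : H, M (WithLp.toLp 2 (x, y)) = WithLp.toLp 2 (u, v) ↔
      (z • x + A x - c • y = u ∧ z • y + A y - c • A x = v) := by
    intro x y u v
    rw [hM, (WithLp.toLp_injective 2).eq_iff, Prod.mk.injEq]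
  have hz : ∀ w : WithLp 2 (H × H), ∃ x y, w = WithLp.toLp 2 (x, y) :=
    fun w => ⟨w.fst, w.snd, rfl⟩
  have h0 : (0 : WithLp 2 (H × H)) = WithLp.toLp 2 ((0 : H), (0 : H)) := rfl
  constructor
  · rintro ⟨hi, hs⟩
    have hi0 : ∀ x y : H, z • x + A x - c • y = 0 → z • y + A y - c • A x = 0 → x = 0 ∧ y = 0 := by
      intro x y h1 h2
      have h3 : M (WithLp.toLp 2 (x, y)) = M 0 := by
        rw [map_zero, h0, hMe]; exact ⟨h1, h2⟩
      have h4 := hi h3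
      rw [h0, (WithLp.toLp_injective 2).eq_iff, Prod.mk.injEq] at h4
      exact h4
    have hs0 : ∀ u v : H, ∃ x y : H, z • x + A x - c • y = u ∧ z • y + A y - c • A x = v := by
      intro u v
      obtain ⟨w, hw⟩ := hs (WithLp.toLp 2 (u, v))
      obtain ⟨x, y, rfl⟩ := hz w
      exact ⟨x, y, (hMe _ _ _ _).1 hw⟩
    constructor
    · rw [injective_iff_map_eq_zero]
      intro x hx
      rw [hD] at hx
      obtain ⟨h1, h2⟩ := hi0 (z • x + A x) (c • A x)
        (by rw [← hx]; simp only [map_add, map_smul]; module)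
        (by simp only [map_add, map_smul]; module)
      refine (hi0 x 0 ?_ ?_).1
      · rw [smul_zero, sub_zero, h1]
      · rw [h2]; simp
    · intro w
      obtain ⟨p, q, h1, h2⟩ := hs0 w 0
      obtain ⟨x, y, h3, h4⟩ := hs0 p (-q)
      refine ⟨x, ?_⟩
      rw [hD, ← h1]
      have h5 : q = -(z • y + A y - c • A x) := by rw [h4, neg_neg]
      rw [h5, ← h3]
      simp only [map_add, map_smul, map_sub]
      module
  · rintro ⟨hi, hs⟩
    rw [injective_iff_map_eq_zero] at hi
    constructor
    · rw [injective_iff_map_eq_zero]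
      intro w hw
      obtain ⟨x, y, rfl⟩ := hz w
      rw [h0, hMe] at hw
      obtain ⟨h1, h2⟩ := hw
      have hx : x = 0 := by
        apply hi
        have : D x = z • (z • x + A x - c • y) + A (z • x + A x - c • y)
          + c • (z • y + A y - c • A x) := by
          rw [hD]; simp only [map_add, map_smul, map_sub]; module
        rw [this, h1, h2]; simp
      have hy : y = 0 := by
        apply hi
        have : D y = z • (z • y + A y - c • A x) + A (z • y + A y - c • A x)
          + c • A (z • x + A x - c • y) := by
          rw [hD]; simp only [map_add, map_smul, map_sub]; module
        rw [this, h1, h2]; simp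
      rw [hx, hy]; rfl
    · intro w
      obtain ⟨u, v, rfl⟩ := hz w
      obtain ⟨a, rfl⟩ := hs u
      obtain ⟨b, rfl⟩ := hs v
      refine ⟨WithLp.toLp 2 (z • a + A a + c • b, z • b + A b + c • A a), ?_⟩
      rw [hMe, hD, hD]
      simp only [map_add, map_smul]
      constructor <;> module

/-- Example 7.1, idealized dynamo with constant α ≡ α₀: let H be a
complex Hilbert space, A : H → H bounded self-adjoint with spectrum contained in
[0,∞), α₀ ∈ ℝ, and let T be the bounded operator on the product Hilbert space
H ×₂ H given by T(x, y) = (−Ax + α₀y, α₀Ax − Ay). Then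
σ(T) = { z ∈ ℂ : ∃ t ∈ σ(A), z = −t + α₀√t or z = −t − α₀√t }. -/
theorem stmt_19 {H : Type*} [NormedAddCommGroup H] [InnerProductSpace ℂ H]
    [CompleteSpace H]
    (A : H →L[ℂ] H) (hA : IsSelfAdjoint A)
    (hspec : ∀ z ∈ spectrum ℂ A, ∃ t : ℝ, 0 ≤ t ∧ z = (t : ℂ))
    (α₀ : ℝ)
    (T : WithLp 2 (H × H) →L[ℂ] WithLp 2 (H × H))
    (hT : ∀ x y : H,
      T ((WithLp.equiv 2 (H × H)).symm (x, y)) =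
        (WithLp.equiv 2 (H × H)).symm (-(A x) + α₀ • y, α₀ • A x - A y)) :
    spectrum ℂ T =
      { z : ℂ | ∃ t : ℝ, (t : ℂ) ∈ spectrum ℂ A ∧
          (z = ((-t + α₀ * Real.sqrt t : ℝ) : ℂ) ∨
           z = ((-t - α₀ * Real.sqrt t : ℝ) : ℂ)) } := by
  ext z
  have key : IsUnit (algebraMap ℂ (WithLp 2 (H × H) →L[ℂ] WithLp 2 (H × H)) z - T) ↔
      IsUnit (Polynomial.aeval A
        ((Polynomial.X + Polynomial.C z) ^ 2
          - Polynomial.C ((α₀ : ℂ) ^ 2) * Polynomial.X : Polynomial ℂ)) := by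
    apply aux_unit A _ (α₀ : ℂ) z
    · intro x
      simp only [map_sub, map_pow, map_add, map_mul, Polynomial.aeval_X, Polynomial.aeval_C,
        Algebra.algebraMap_eq_smul_one, pow_two]
      simp
      module
    · intro x y
      have h := hT x y
      simp only [WithLp.equiv_symm_apply] at h
      rw [ContinuousLinearMap.sub_apply, h, Algebra.algebraMap_eq_smul_one,
        ContinuousLinearMap.smul_apply, ContinuousLinearMap.one_apply,
        ← WithLp.toLp_smul, ← WithLp.toLp_sub]
      congr 1
      simp only [Prod.smul_mk, Prod.mk_sub_mk, Prod.mk.injEq, Complex.coe_smul]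
      constructor <;> abel
  have hdeg : 0 < ((Polynomial.X + Polynomial.C z) ^ 2
          - Polynomial.C ((α₀ : ℂ) ^ 2) * Polynomial.X : Polynomial ℂ).degree := by
    have : ((Polynomial.X + Polynomial.C z) ^ 2
          - Polynomial.C ((α₀ : ℂ) ^ 2) * Polynomial.X : Polynomial ℂ).degree = 2 := by
      compute_degree!
    rw [this]; norm_num
  have hmap := spectrum.map_polynomial_aeval_of_degree_pos A _ hdeg
  rw [spectrum.mem_iff, key, ← spectrum.zero_mem_iff ℂ, hmap]
  have hreal : ∀ t : ℝ, 0 ≤ t → (((t : ℂ) + z) ^ 2 - (α₀ : ℂ) ^ 2 * t = 0 ↔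
      (z = ((-t + α₀ * Real.sqrt t : ℝ) : ℂ) ∨ z = ((-t - α₀ * Real.sqrt t : ℝ) : ℂ))) := by
    intro t ht
    have hs : (t : ℂ) = (Real.sqrt t : ℂ) ^ 2 := by
      rw [← Complex.ofReal_pow, Real.sq_sqrt ht]
    have hf : ((t : ℂ) + z) ^ 2 - (α₀ : ℂ) ^ 2 * t =
        (z - ((-t + α₀ * Real.sqrt t : ℝ) : ℂ)) * (z - ((-t - α₀ * Real.sqrt t : ℝ) : ℂ)) := by
      push_cast
      linear_combination (-(α₀ : ℂ) ^ 2) * hs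
    rw [hf, mul_eq_zero, sub_eq_zero, sub_eq_zero]
  simp only [Set.mem_image, Set.mem_setOf_eq, Polynomial.eval_sub, Polynomial.eval_pow,
    Polynomial.eval_add, Polynomial.eval_X, Polynomial.eval_C, Polynomial.eval_mul]
  constructor
  · rintro ⟨k, hk, h⟩
    obtain ⟨t, ht, rfl⟩ := hspec k hk
    exact ⟨t, hk, (hreal t ht).1 h⟩
  · rintro ⟨t, hk, h⟩
    obtain ⟨s, hs, hst⟩ := hspec _ hk
    have : t = s := by exact_mod_cast hst
    subst this
    exact ⟨t, hk, (hreal t hs).2 h⟩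
end
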